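/- Let k ≥ 3 be an integer. For every real d ∈ (0,1] there exists ℓ ∈ ℕ such that 1/(2(k−1)^ℓ) ≤ γ(Z_ℓ^{(k)}) ≤ d. -/

import Mathlib

open Finset

open scoped Classical

/-- The degree of a set of vertices `s` in the edge set `E`: the number of edges containing `s`. -/
noncomputable def hdeg {α : Type*} [DecidableEq α] (E : Finset (Finset α)) (s : Finset α) : ℕ :=
  (E.filter fun e => s ⊆ e).card

/-- The hypergraph with edge set `F` (on vertex type `α`) has a copy inside the hypergraph with
edge set `E` (on vertex type `β`). -/
def HasCopy {α β : Type*} [DecidableEq β] (F : Finset (Finset α)) (E : Finset (Finset β)) :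
    Prop :=
  ∃ f : α → β, Function.Injective f ∧ ∀ e ∈ F, e.image f ∈ E

/-- The codegree Turán number `exco k n F`: the largest `d` such that some `F`-free `k`-uniform
hypergraph on `n` vertices has minimum codegree at least `d`. -/
noncomputable def exco {α : Type*} (k n : ℕ) (F : Finset (Finset α)) : ℕ :=
  sSup {d : ℕ | ∃ E : Finset (Finset (Fin n)), (∀ e ∈ E, e.card = k) ∧ ¬ HasCopy F E ∧
    ∀ s : Finset (Fin n), s.card = k - 1 → d ≤ hdeg E s}

/-- The codegree Turán density `γ(F)`. -/
noncomputable def codegTuranDensity {α : Type*} (k : ℕ) (F : Finset (Finset α)) : ℝ :=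
  Filter.limsup (fun n : ℕ => (exco k n F : ℝ) / n) Filter.atTop

/-- The `k`-uniform zycle of length `ℓ`: vertices are pairs `(i, j)` with `i ∈ Fin ℓ`,
`j ∈ Fin (k-1)`; for each `i, j` there is an edge `{(i, 1), …, (i, k-1), (i+1, j)}`
(first coordinate taken modulo `ℓ`). -/
def zycle (k ℓ : ℕ) : Finset (Finset (Fin ℓ × Fin (k - 1))) :=
  Finset.univ.image fun p : Fin ℓ × Fin (k - 1) =>
    insert (⟨(p.1.val + 1) % ℓ, Nat.mod_lt _ p.1.pos⟩, p.2)
      (Finset.univ.image fun j : Fin (k - 1) => (p.1, j))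

/-- `e ▷ f` : every extension of `e` by a vertex of `f` is an edge. -/
def Tri {α : Type*} [DecidableEq α] (E : Finset (Finset α)) (e f : Finset α) : Prop :=
  ∀ v ∈ f, insert v e ∈ E

/-- In a `k`-uniform hypergraph the degree of a `(k-1)`-set counts the vertices completing it to
an edge. -/
lemma hdeg_eq_card_filter {α : Type*} [Fintype α] [DecidableEq α] {k : ℕ} (hk : 0 < k)
    {E : Finset (Finset α)} (hE : ∀ e ∈ E, e.card = k) {s : Finset α} (hs : s.card = k - 1) :
    hdeg E s = (univ.filter fun v => v ∉ s ∧ insert v s ∈ E).card := by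
  have himage : (E.filter fun e => s ⊆ e) =
      (univ.filter fun v => v ∉ s ∧ insert v s ∈ E).image fun v => insert v s := by
    ext e
    simp only [mem_filter, mem_image, mem_univ, true_and]
    constructor
    · rintro ⟨he, hse⟩
      have hcard : (e \ s).card = 1 := by
        rw [card_sdiff_of_subset hse, hE e he, hs]
        omega
      obtain ⟨v, hv⟩ := card_eq_one.mp hcard
      have hvs : v ∉ s := (mem_sdiff.mp (hv ▸ mem_singleton_self v : v ∈ e \ s)).2
      have hins : insert v s = e := by
        rw [insert_eq, ← hv, sdiff_union_of_subset hse]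
      exact ⟨v, ⟨hvs, hins ▸ he⟩, hins⟩
    · rintro ⟨v, ⟨-, hv⟩, rfl⟩
      exact ⟨hv, subset_insert v s⟩
  rw [hdeg, himage, card_image_of_injOn]
  intro v hv w hw hvw
  simp only [coe_filter, mem_univ, true_and, Set.mem_ofPred_eq] at hv hw
  have : v ∈ insert w s := by
    rw [← show insert v s = insert w s from hvw]
    exact mem_insert_self v s
  exact (mem_insert.mp this).resolve_right hv.1

/-- A dense set of tuples `ι → Fin n` contains a box all of whose sides have size `t`
(the theorem of Erdős on complete multipartite subhypergraphs). -/
lemma exists_box (ι : Type) [Fintype ι] (t : ℕ) : ∀ ε : ℝ, 0 < ε → ∃ n₀ : ℕ, ∀ n ≥ n₀,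
    ∀ S : Finset (ι → Fin n), ε * (n : ℝ) ^ Fintype.card ι ≤ S.card →
      ∃ A : ι → Finset (Fin n), (∀ i, (A i).card = t) ∧ ∀ x, (∀ i, x i ∈ A i) → x ∈ S := by
  refine Fintype.induction_empty_option (P := fun ι [Fintype ι] => ∀ ε : ℝ, 0 < ε → ∃ n₀ : ℕ,
    ∀ n ≥ n₀, ∀ S : Finset (ι → Fin n), ε * (n : ℝ) ^ Fintype.card ι ≤ S.card →
      ∃ A : ι → Finset (Fin n), (∀ i, (A i).card = t) ∧ ∀ x, (∀ i, x i ∈ A i) → x ∈ S)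
    ?_ ?_ ?_ ι
  · intro α β _ e ih ε hε
    let := Fintype.ofEquiv β e.symm
    obtain ⟨n₀, h⟩ := ih ε hε
    refine ⟨n₀, fun n hn S hS => ?_⟩
    obtain ⟨A, hA, hAS⟩ := h n hn (S.map (e.symm.arrowCongr (Equiv.refl _)).toEmbedding) (by
      rw [card_map, Fintype.card_congr e]
      exact hS)
    refine ⟨fun b => A (e.symm b), fun b => hA _, fun x hx => ?_⟩
    have hmem := hAS (x ∘ e) (fun a => by simpa using hx (e a))
    rw [mem_map] at hmem
    obtain ⟨y, hy, hyx⟩ := hmem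
    have : y = x := by
      funext b
      simpa using congrFun hyx (e.symm b)
    exact this ▸ hy
  · intro ε hε
    refine ⟨0, fun n _ S hS => ⟨fun i => i.elim, fun i => i.elim, fun x _ => ?_⟩⟩
    have hpos : (0 : ℝ) < S.card := by
      refine lt_of_lt_of_le ?_ hS
      simpa using hε
    obtain ⟨y, hy⟩ := card_pos.mp (by exact_mod_cast hpos)
    exact Subsingleton.elim y x ▸ hy
  · intro ι _ ih ε hε
    obtain ⟨K, hK⟩ := exists_nat_ge (4 * t / ε + 1)
    have hK0 : (0 : ℝ) < K := lt_of_lt_of_le (by positivity) hK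
    have hKt : 4 * (t : ℝ) ≤ K * ε := by
      have : 4 * t / ε ≤ K := by linarith
      rwa [div_le_iff₀ hε] at this
    obtain ⟨n₁, h₁⟩ := ih (ε / (4 * 2 ^ K)) (by positivity)
    obtain ⟨n₂, h₂⟩ := exists_nat_ge (2 * K / ε)
    refine ⟨max 1 (max n₁ n₂), fun n hn S hS => ?_⟩
    have hn0 : (0 : ℝ) < n := by
      exact_mod_cast (le_trans (le_max_left _ _) hn : 1 ≤ n)
    have hn₁ : n₁ ≤ n := le_trans (le_trans (le_max_left _ _) (le_max_right _ _)) hn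
    have hn₂ : 2 * (K : ℝ) ≤ n * ε := by
      have : (n₂ : ℝ) ≤ n := by
        exact_mod_cast le_trans (le_trans (le_max_right _ _) (le_max_right _ _)) hn
      have := h₂.trans this
      rwa [div_le_iff₀ hε] at this
    set Q : ℝ := (n : ℝ) ^ Fintype.card ι with hQ
    have hQ0 : 0 < Q := by positivity
    have hcardι : (Fintype.card (ι → Fin n) : ℝ) = Q := by simp [hQ]
    let cons : Fin n → (ι → Fin n) → Option ι → Fin n := fun x y o => o.elim x y
    have hcons : ∀ z : Option ι → Fin n, cons (z none) (fun i => z (some i)) = z := by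
      intro z
      funext o
      cases o <;> rfl
    let F : Fin n → Finset (ι → Fin n) := fun x => univ.filter fun y => cons x y ∈ S
    have hF : ∀ x, ((F x).card : ℝ) ≤ Q := fun x => by
      rw [← hcardι]
      exact_mod_cast card_le_univ _
    have hSF : (S.card : ℝ) ≤ ∑ x, ((F x).card : ℝ) := by
      rw [card_eq_sum_card_fiberwise (f := fun z => z none) (t := univ) (fun _ _ => mem_univ _)]
      push_cast
      refine sum_le_sum fun x _ => ?_
      have := card_le_card_of_injOn (s := S.filter fun z => z none = x) (t := F x)
        (fun z i => z (some i)) (by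
          intro z hz
          simp only [coe_filter, Set.mem_ofPred_eq] at hz
          simp only [F, coe_filter, mem_univ, true_and, Set.mem_ofPred_eq]
          rw [← hz.2, hcons]
          exact hz.1) (by
          intro z hz w hw hzw
          simp only [coe_filter, Set.mem_ofPred_eq] at hz hw
          rw [← hcons z, ← hcons w, hz.2, hw.2]
          exact congrArg _ hzw)
      exact_mod_cast this
    let X : Finset (Fin n) := univ.filter fun x => ε / 2 * Q ≤ (F x).card
    have hX : K ≤ X.card := by
      have hsum : ∑ x, ((F x).card : ℝ) ≤ X.card * Q + n * (ε / 2 * Q) := by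
        calc ∑ x, ((F x).card : ℝ)
            ≤ ∑ x : Fin n, ((if x ∈ X then Q else 0) + ε / 2 * Q) := by
              refine sum_le_sum fun x _ => ?_
              split_ifs with hx
              · have : 0 ≤ ε / 2 * Q := by positivity
                linarith [hF x]
              · have : ¬ ε / 2 * Q ≤ (F x).card := fun h => hx (by simp [X, h])
                linarith
          _ = X.card * Q + n * (ε / 2 * Q) := by
              rw [sum_add_distrib, ← sum_filter]
              simp
      have hpow : (n : ℝ) ^ Fintype.card (Option ι) = n * Q := by
        rw [Fintype.card_option, pow_succ, mul_comm]
      rw [hpow] at hS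
      have : (n * ε / 2) * Q ≤ X.card * Q := by nlinarith
      have := le_of_mul_le_mul_right this hQ0
      have : (K : ℝ) ≤ X.card := by linarith
      exact_mod_cast this
    obtain ⟨W, hWX, hWK⟩ := exists_subset_card_eq hX
    let G : (ι → Fin n) → Finset (Fin n) := fun y => W.filter fun x => cons x y ∈ S
    have hG : ∀ y, ((G y).card : ℝ) ≤ K := fun y => by
      rw [← hWK]
      exact_mod_cast card_le_card (filter_subset _ _)
    have hdouble : ∑ x ∈ W, ((F x).card : ℝ) = ∑ y, ((G y).card : ℝ) := by
      exact_mod_cast sum_card_bipartiteAbove_eq_sum_card_bipartiteBelow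
        (s := W) (t := univ) fun x y => cons x y ∈ S
    let Y : Finset (ι → Fin n) := univ.filter fun y => t ≤ (G y).card
    have hY : ε / 4 * Q ≤ Y.card := by
      have hlow : K * (ε / 2 * Q) ≤ ∑ x ∈ W, ((F x).card : ℝ) := by
        rw [← hWK, ← nsmul_eq_mul]
        exact card_nsmul_le_sum _ _ _ fun x hx => (mem_filter.mp (hWX hx)).2
      have hupp : ∑ y, ((G y).card : ℝ) ≤ Y.card * K + Q * t := by
        calc ∑ y, ((G y).card : ℝ)
            ≤ ∑ y : ι → Fin n, ((if y ∈ Y then (K : ℝ) else 0) + t) := by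
              refine sum_le_sum fun y _ => ?_
              split_ifs with hy
              · linarith [hG y, (Nat.cast_nonneg t : (0 : ℝ) ≤ t)]
              · have : (G y).card ≤ t := le_of_not_ge fun h => hy (by simp [Y, h])
                have : ((G y).card : ℝ) ≤ t := by exact_mod_cast this
                linarith
          _ = Y.card * K + Q * t := by
              rw [sum_add_distrib, ← sum_filter, sum_const, sum_const, card_univ]
              simp [hQ]
      have h4 : Q * (4 * t) ≤ Q * (K * ε) := mul_le_mul_of_nonneg_left hKt hQ0.le
      have : (ε / 4 * Q) * K ≤ Y.card * K := by linarith
      exact le_of_mul_le_mul_right this hK0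
    obtain ⟨T, hT, hTcard⟩ := exists_le_card_fiber_of_nsmul_le_card_of_maps_to
      (s := Y) (t := W.powerset) (f := G) (b := ε / (4 * 2 ^ K) * Q)
      (fun y _ => mem_powerset.mpr (filter_subset _ _)) ⟨∅, by simp⟩ (by
        rw [card_powerset, hWK, nsmul_eq_mul]
        refine le_trans (le_of_eq ?_) hY
        push_cast
        field_simp)
    have hTt : t ≤ T.card := by
      have : (0 : ℝ) < (Y.filter fun y => G y = T).card := lt_of_lt_of_le (by positivity) hTcard
      obtain ⟨y, hy⟩ := card_pos.mp (by exact_mod_cast this)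
      obtain ⟨hyY, rfl⟩ := mem_filter.mp hy
      exact (mem_filter.mp hyY).2
    obtain ⟨T', hT'T, hT't⟩ := exists_subset_card_eq hTt
    obtain ⟨A, hA, hAS⟩ := h₁ n hn₁ _ hTcard
    refine ⟨fun o => o.elim T' A, fun o => ?_, fun z hz => ?_⟩
    · cases o
      · exact hT't
      · exact hA _
    · have hmem := (mem_filter.mp (hAS (fun i => z (some i)) fun i => hz (some i))).2
      have hz0 : z none ∈ G fun i => z (some i) := hmem ▸ hT'T (hz none)
      rw [← hcons z]
      exact (mem_filter.mp hz0).2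

/-- In a digraph where all vertices satisfying `p` have out-density at least `ε`, few tuples
contain a vertex satisfying `p` without out-neighbours among the other entries. -/
lemma card_tuples_with_sink_le {V : Type*} [Fintype V] (R : V → V → Prop) (p : V → Prop)
    {ε : ℝ} (hε : ε ≤ 1)
    (hR : ∀ v, p v → ε * Fintype.card V ≤ (univ.filter fun w => R v w).card) (m : ℕ) :
    ((univ.filter fun x : Fin (m + 1) → V =>
        ∃ i, p (x i) ∧ ∀ j, j ≠ i → ¬ R (x i) (x j)).card : ℝ) ≤
      (m + 1) * (1 - ε) ^ m * (Fintype.card V : ℝ) ^ (m + 1) := by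
  let N : V → Finset V := fun v => univ.filter fun w => ¬ R v w
  let B : Fin (m + 1) → V → Finset (Fin (m + 1) → V) := fun i v =>
    Fintype.piFinset fun j => if j = i then {v} else N v
  have hsub : (univ.filter fun x : Fin (m + 1) → V =>
      ∃ i, p (x i) ∧ ∀ j, j ≠ i → ¬ R (x i) (x j)) ⊆
      univ.biUnion fun i => (univ.filter p).biUnion (B i) := by
    intro x hx
    obtain ⟨i, hp, hi⟩ := (mem_filter.mp hx).2
    simp only [mem_biUnion, mem_univ, true_and, mem_filter]
    refine ⟨i, x i, hp, Fintype.mem_piFinset.mpr fun j => ?_⟩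
    split_ifs with hj
    · simp [hj]
    · simpa [N] using hi j hj
  have hB : ∀ i v, p v → ((B i v).card : ℝ) ≤ (1 - ε) ^ m * (Fintype.card V : ℝ) ^ m := by
    intro i v hv
    have hcard : (B i v).card = (N v).card ^ m := by
      rw [Fintype.card_piFinset, Fintype.prod_eq_mul_prod_compl i]
      rw [prod_congr rfl (g := fun _ => (N v).card)]
      · simp [card_compl]
      · intro j hj
        rw [if_neg (by simpa using hj)]
    have hN : ((N v).card : ℝ) ≤ (1 - ε) * Fintype.card V := by
      have h := card_filter_add_card_filter_not (s := (univ : Finset V)) (fun w => R v w)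
      have h' : ((univ.filter fun w => R v w).card : ℝ) + (N v).card = Fintype.card V := by
        exact_mod_cast h
      linarith [hR v hv]
    rw [hcard, ← mul_pow]
    push_cast
    exact pow_le_pow_left₀ (Nat.cast_nonneg _) hN m
  have hnonneg : 0 ≤ (1 - ε) ^ m * (Fintype.card V : ℝ) ^ m :=
    mul_nonneg (pow_nonneg (sub_nonneg.mpr hε) m) (by positivity)
  calc _ ≤ ((univ.biUnion fun i => (univ.filter p).biUnion (B i)).card : ℝ) := by
        exact_mod_cast card_le_card hsub
    _ ≤ ∑ i : Fin (m + 1), ∑ v ∈ univ.filter p, ((B i v).card : ℝ) := by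
        exact_mod_cast card_biUnion_le.trans (sum_le_sum fun i _ => card_biUnion_le)
    _ ≤ ∑ i : Fin (m + 1), ∑ v : V, (1 - ε) ^ m * (Fintype.card V : ℝ) ^ m := by
        refine sum_le_sum fun i _ => ?_
        refine (sum_le_sum fun v hv => hB i v (mem_filter.mp hv).2).trans ?_
        exact sum_le_sum_of_subset_of_nonneg (subset_univ _) fun _ _ _ => hnonneg
    _ = _ := by
        simp
        ring

/-- Few tuples are not injective. -/
lemma card_not_injective_le (ι : Type*) [Fintype ι] (n : ℕ) :
    n * (univ.filter fun z : ι → Fin n => ¬ Function.Injective z).card ≤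
      Fintype.card ι ^ 2 * n ^ Fintype.card ι := by
  let P : Finset (ι × ι) := univ.filter fun p => p.1 ≠ p.2
  let C : ι × ι → Finset (ι → Fin n) := fun p => univ.filter fun z => z p.1 = z p.2
  have hsub : (univ.filter fun z : ι → Fin n => ¬ Function.Injective z) ⊆ P.biUnion C := by
    intro z hz
    have hz' := (mem_filter.mp hz).2
    simp only [Function.Injective, not_forall] at hz'
    obtain ⟨a, b, hab, hne⟩ := hz'
    simp only [mem_biUnion]
    exact ⟨(a, b), by simpa [P] using hne, by simpa [C] using hab⟩
  have hC : ∀ p ∈ P, n * (C p).card ≤ n ^ Fintype.card ι := by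
    intro p hp
    have hne : p.1 ≠ p.2 := (mem_filter.mp hp).2
    have := card_le_card_of_injOn (s := (univ : Finset (Fin n)) ×ˢ C p)
      (t := (univ : Finset (ι → Fin n))) (fun q => Function.update q.2 p.1 q.1)
      (fun _ _ => by simp) (by
        rintro ⟨a, z⟩ hz ⟨b, w⟩ hw h
        simp only [C, coe_product, coe_univ, coe_filter, mem_univ, true_and, Set.mem_prod,
          Set.mem_univ, Set.mem_ofPred_eq] at hz hw
        simp only at h
        have hval := fun i => congrFun h i
        have hother : ∀ i, i ≠ p.1 → z i = w i := fun i hi => by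
          simpa [Function.update_of_ne hi] using hval i
        have hab : a = b := by simpa using hval p.1
        have hzw : z = w := by
          funext i
          by_cases hi : i = p.1
          · rw [hi, hz, hw, hother _ hne.symm]
          · exact hother i hi
        rw [hab, hzw])
    simpa using this
  calc n * (univ.filter fun z : ι → Fin n => ¬ Function.Injective z).card
      ≤ n * ∑ p ∈ P, (C p).card :=
        Nat.mul_le_mul_left _ ((card_le_card hsub).trans card_biUnion_le)
    _ ≤ ∑ p ∈ P, n ^ Fintype.card ι := by
        rw [mul_sum]
        exact sum_le_sum hC
    _ ≤ Fintype.card ι ^ 2 * n ^ Fintype.card ι := by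
        rw [sum_const, smul_eq_mul]
        refine Nat.mul_le_mul_right _ ((card_le_univ P).trans ?_)
        simp [sq]

lemma exists_iterate_factorial_eq {m : ℕ} (h : Fin (m + 1) → Fin (m + 1)) :
    ∃ a, h^[(m + 1).factorial] a = a := by
  obtain ⟨p, q, hpq, heq⟩ := Fintype.exists_ne_map_eq_of_card_lt
    (fun i : Fin (m + 2) => h^[i] 0) (by simp)
  wlog hlt : p < q generalizing p q
  · exact this q p hpq.symm heq.symm (lt_of_le_of_ne (not_lt.mp hlt) hpq.symm)
  refine ⟨h^[p] 0, ?_⟩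
  have hlt' : (p : ℕ) < q := hlt
  have hper : Function.IsPeriodicPt h (q - p : ℕ) (h^[p] 0) := by
    rw [Function.IsPeriodicPt, Function.IsFixedPt, ← Function.iterate_add_apply,
      Nat.sub_add_cancel hlt'.le]
    exact heq.symm
  exact hper.trans_dvd (Nat.dvd_factorial (by omega) (by omega))

/-- If every transversal of a box is injective and satisfies `x i ▷ x (h i)` for a self-map `h`
of the index set without fixed points, then a closed `h`-orbit yields a zycle. -/
lemma hasCopy_zycle_of_box {ι : Type*} {k ℓ n : ℕ} {E : Finset (Finset (Fin n))} {h : ι → ι}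
    (hne : ∀ i, h i ≠ i) {a : ι} (ha : h^[ℓ] a = a) {A : ι × Fin (k - 1) → Finset (Fin n)}
    (hA : ∀ p, (A p).card = ℓ)
    (hbox : ∀ x : ι × Fin (k - 1) → Fin n, (∀ p, x p ∈ A p) → Function.Injective x ∧
      ∀ i j, insert (x (h i, j)) (univ.image fun j' => x (i, j')) ∈ E) :
    HasCopy (zycle k ℓ) E := by
  let e : ∀ p, Fin ℓ ↪o Fin n := fun p => (A p).orderEmbOfFin (hA p)
  have he : ∀ p i, e p i ∈ A p := fun p i => orderEmbOfFin_mem _ _ _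
  let f : Fin ℓ × Fin (k - 1) → Fin n := fun q => e (h^[q.1] a, q.2) q.1
  refine ⟨f, ?_, ?_⟩
  · rintro ⟨i, j⟩ ⟨i', j'⟩ hf
    simp only [f] at hf
    by_cases hp : (h^[i] a, j) = (h^[i'] a, j')
    · rw [hp] at hf
      have hi := (e _).injective hf
      have hj := congrArg Prod.snd hp
      exact Prod.ext hi hj
    · have hinj := (hbox (fun q => if q = (h^[i] a, j) then e q i else e q i') fun q => by
        split_ifs
        · exact he _ _
        · exact he _ _).1
      refine absurd (hinj (a₁ := (h^[i] a, j)) (a₂ := (h^[i'] a, j')) ?_) hp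
      beta_reduce
      rwa [if_pos rfl, if_neg (Ne.symm hp)]
  · intro s hs
    obtain ⟨⟨i, j⟩, -, rfl⟩ := mem_image.mp hs
    set i' : Fin ℓ := ⟨(i.val + 1) % ℓ, Nat.mod_lt _ i.pos⟩ with hi'
    have hstep : h^[i'] a = h (h^[i] a) := by
      rw [← Function.iterate_succ_apply' h]
      rcases Nat.lt_or_ge (i.val + 1) ℓ with hlt | hge
      · simp only [hi', Nat.mod_eq_of_lt hlt]
      · have : i.val + 1 = ℓ := le_antisymm i.isLt hge
        simp only [hi', this, Nat.mod_self, Nat.succ_eq_add_one, ha, Function.iterate_zero, id]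
    have hedge := (hbox (fun q => if q.1 = h^[i] a then e q i else e q i') fun q => by
        split_ifs
        · exact he _ _
        · exact he _ _).2 (h^[i] a) j
    simp only [if_neg (hne (h^[i] a)), if_true] at hedge
    rw [image_insert, image_image]
    simpa only [f, hstep, Function.comp_def] using hedge

/-- Large codegree forces, for most choices of `m + 1` tuples of `k - 1` vertices, that each tuple
`▷`-dominates another one. -/
lemma card_dominated_tuples_ge {k n m : ℕ} (hk : 0 < k) {d : ℝ} (hd : 0 ≤ d) (hd1 : d ≤ 1)
    {E : Finset (Finset (Fin n))} (hE : ∀ e ∈ E, e.card = k)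
    (hdeg : ∀ s : Finset (Fin n), s.card = k - 1 → d * n ≤ hdeg E s)
    (hm : ((m : ℝ) + 1) * (1 - d ^ (k - 1)) ^ m ≤ 1 / 4)
    (hn : 4 * ((m + 1) * (k - 1)) ^ 2 ≤ n) (hn0 : 0 < n) :
    1 / 2 * (n : ℝ) ^ ((m + 1) * (k - 1)) ≤
      (univ.filter fun z : Fin (m + 1) × Fin (k - 1) → Fin n => Function.Injective z ∧
        ∀ i, ∃ i', i' ≠ i ∧
          ∀ j, insert (z (i', j)) (univ.image fun j' => z (i, j')) ∈ E).card := by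
  set q := (m + 1) * (k - 1) with hq
  let R : (Fin (k - 1) → Fin n) → (Fin (k - 1) → Fin n) → Prop := fun u w =>
    ∀ j, insert (w j) (univ.image u) ∈ E
  have hR : ∀ u : Fin (k - 1) → Fin n, Function.Injective u →
      d ^ (k - 1) * Fintype.card (Fin (k - 1) → Fin n) ≤ (univ.filter fun w => R u w).card := by
    intro u hu
    have hcard : (univ.image u).card = k - 1 := by simp [card_image_of_injective _ hu]
    have hpi : (univ.filter fun w => R u w) =
        Fintype.piFinset fun _ => univ.filter fun v => insert v (univ.image u) ∈ E := by
      ext w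
      simp [R, Fintype.mem_piFinset]
    have hdn := hdeg _ hcard
    rw [hdeg_eq_card_filter hk hE hcard] at hdn
    rw [hpi, Fintype.card_piFinset]
    simp only [prod_const, card_univ, Fintype.card_fin, Fintype.card_fun]
    push_cast
    rw [← mul_pow]
    refine pow_le_pow_left₀ (by positivity) (hdn.trans ?_) _
    exact_mod_cast card_le_card fun v hv => by
      simp only [mem_filter, mem_univ, true_and] at hv ⊢
      exact hv.2
  set good := univ.filter fun z : Fin (m + 1) × Fin (k - 1) → Fin n => Function.Injective z ∧
        ∀ i, ∃ i', i' ≠ i ∧ ∀ j, insert (z (i', j)) (univ.image fun j' => z (i, j')) ∈ E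
  set ninj := univ.filter fun z : Fin (m + 1) × Fin (k - 1) → Fin n => ¬ Function.Injective z
  set sink := univ.filter fun x : Fin (m + 1) → Fin (k - 1) → Fin n =>
        ∃ i, Function.Injective (x i) ∧ ∀ j, j ≠ i → ¬ R (x i) (x j)
  have hsink : (sink.card : ℝ) ≤ (m + 1) * (1 - d ^ (k - 1)) ^ m *
      (Fintype.card (Fin (k - 1) → Fin n) : ℝ) ^ (m + 1) := by
    convert card_tuples_with_sink_le R Function.Injective (pow_le_one₀ hd hd1)
      (fun u hu => by convert hR u hu) m
  have hninj : n * ninj.card ≤ q ^ 2 * n ^ q := by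
    convert card_not_injective_le (Fin (m + 1) × Fin (k - 1)) n <;> simp [hq]
  have hcover : (univ : Finset (Fin (m + 1) × Fin (k - 1) → Fin n)) ⊆
      good ∪ (ninj ∪ sink.map (Equiv.curry _ _ _).symm.toEmbedding) := by
    intro z _
    by_cases hz : Function.Injective z
    swap
    · simp [ninj, hz]
    by_cases hgood : z ∈ good
    · exact mem_union_left _ hgood
    · refine mem_union_right _ (mem_union_right _ ?_)
      have hnot : ¬ ∀ i, ∃ i', i' ≠ i ∧
          ∀ j, insert (z (i', j)) (univ.image fun j' => z (i, j')) ∈ E := fun h =>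
        hgood (mem_filter.mpr ⟨mem_univ _, hz, h⟩)
      obtain ⟨i, hi⟩ := not_forall.mp hnot
      refine mem_map.mpr ⟨Equiv.curry _ _ _ z, mem_filter.mpr ⟨mem_univ _, i, ?_, ?_⟩, by simp⟩
      · intro j j' hj
        exact congrArg Prod.snd (hz hj)
      · exact fun i' hi' hRi => hi ⟨i', hi', hRi⟩
  have htotal : (n : ℝ) ^ q ≤ good.card + (ninj.card + sink.card) := by
    have h := (card_le_card hcover).trans
      ((card_union_le _ _).trans (Nat.add_le_add_left (card_union_le _ _) _))
    rw [card_map] at h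
    have h' : n ^ q ≤ good.card + (ninj.card + sink.card) := by
      simpa [hq] using h
    exact_mod_cast h'
  have hpow : (Fintype.card (Fin (k - 1) → Fin n) : ℝ) ^ (m + 1) = (n : ℝ) ^ q := by
    simp [hq, ← pow_mul, mul_comm]
  rw [hpow] at hsink
  have hsink' : (sink.card : ℝ) ≤ 1 / 4 * (n : ℝ) ^ q :=
    hsink.trans (mul_le_mul_of_nonneg_right hm (by positivity))
  have hninj' : (ninj.card : ℝ) ≤ 1 / 4 * (n : ℝ) ^ q := by
    have h1 : (n : ℝ) * ninj.card ≤ (q : ℝ) ^ 2 * (n : ℝ) ^ q := by exact_mod_cast hninj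
    have h2 : 4 * (q : ℝ) ^ 2 ≤ n := by exact_mod_cast hn
    have h3 : (0 : ℝ) < n := by exact_mod_cast hn0
    have h4 : (n : ℝ) * ninj.card ≤ n * (1 / 4 * (n : ℝ) ^ q) := by
      have := mul_le_mul_of_nonneg_right h2 (by positivity : (0 : ℝ) ≤ (n : ℝ) ^ q)
      linarith
    exact le_of_mul_le_mul_left h4 h3
  linarith

/-- For every `d > 0` there is `ℓ` such that codegree `d n` forces a zycle of length `ℓ`. -/
theorem exists_zycle_of_codegree {k : ℕ} (hk : 2 ≤ k) {d : ℝ} (hd : 0 < d) (hd1 : d ≤ 1) :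
    ∃ ℓ : ℕ, 1 ≤ ℓ ∧ ∃ n₀ : ℕ, ∀ n ≥ n₀, ∀ E : Finset (Finset (Fin n)),
      (∀ e ∈ E, e.card = k) → (∀ s : Finset (Fin n), s.card = k - 1 → d * n ≤ hdeg E s) →
        HasCopy (zycle k ℓ) E := by
  obtain ⟨m, hm⟩ : ∃ m : ℕ, ((m : ℝ) + 1) * (1 - d ^ (k - 1)) ^ m ≤ 1 / 4 := by
    have hr0 : 0 ≤ 1 - d ^ (k - 1) := sub_nonneg.mpr (pow_le_one₀ hd.le hd1)
    have hr1 : 1 - d ^ (k - 1) < 1 := sub_lt_self _ (by positivity)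
    have hlim := (tendsto_self_mul_const_pow_of_lt_one hr0 hr1).add
      (tendsto_pow_atTop_nhds_zero_of_lt_one hr0 hr1)
    rw [add_zero] at hlim
    obtain ⟨m, hm⟩ := (hlim.eventually (Iio_mem_nhds (by norm_num : (0 : ℝ) < 1 / 4))).exists
    refine ⟨m, ?_⟩
    rw [add_mul, one_mul]
    exact (Set.mem_Iio.mp hm).le
  set H : ℕ := Fintype.card (Fin (m + 1) → Fin (m + 1)) with hH
  have hH0 : (0 : ℝ) < H := by
    exact_mod_cast Fintype.card_pos
  obtain ⟨n₁, hbox⟩ := exists_box (Fin (m + 1) × Fin (k - 1)) (m + 1).factorial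
    (1 / (2 * H)) (by positivity)
  refine ⟨(m + 1).factorial, Nat.factorial_pos _,
    max 1 (max n₁ (4 * ((m + 1) * (k - 1)) ^ 2)), fun n hn E hE hdeg => ?_⟩
  have hn0 : 0 < n := le_trans (le_max_left _ _) hn
  have hn₁ : n₁ ≤ n := le_trans (le_trans (le_max_left _ _) (le_max_right _ _)) hn
  have hn₂ := le_trans (le_trans (le_max_right _ _) (le_max_right _ _)) hn
  have hgood := card_dominated_tuples_ge (by omega) hd.le hd1 hE hdeg hm hn₂ hn0
  set good := univ.filter fun z : Fin (m + 1) × Fin (k - 1) → Fin n => Function.Injective z ∧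
        ∀ i, ∃ i', i' ≠ i ∧ ∀ j, insert (z (i', j)) (univ.image fun j' => z (i, j')) ∈ E
  have hchoice : ∀ z, ∃ g : Fin (m + 1) → Fin (m + 1), z ∈ good → ∀ i, g i ≠ i ∧
      ∀ j, insert (z (g i, j)) (univ.image fun j' => z (i, j')) ∈ E := by
    intro z
    by_cases hz : z ∈ good
    · choose g hg using (mem_filter.mp hz).2.2
      exact ⟨g, fun _ => hg⟩
    · exact ⟨id, fun h => absurd h hz⟩
  choose g hg using hchoice
  obtain ⟨h, -, hcard⟩ := exists_le_card_fiber_of_nsmul_le_card_of_maps_to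
    (s := good) (t := univ) (f := g) (b := 1 / (2 * H) * (n : ℝ) ^ ((m + 1) * (k - 1)))
    (fun _ _ => mem_univ _) univ_nonempty (by
      rw [card_univ, ← hH, nsmul_eq_mul]
      refine le_trans (le_of_eq ?_) hgood
      field_simp)
  obtain ⟨A, hA, hAS⟩ := hbox n hn₁ _ (by simpa using hcard)
  have hn_pos : (0 : ℝ) < n := by exact_mod_cast hn0
  have hne : ∀ i, h i ≠ i := by
    have hpos : (0 : ℝ) < (good.filter fun z => g z = h).card :=
      lt_of_lt_of_le (by positivity) hcard
    obtain ⟨z, hz⟩ := card_pos.mp (by exact_mod_cast hpos)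
    obtain ⟨hzg, rfl⟩ := mem_filter.mp hz
    exact fun i => (hg z hzg i).1
  obtain ⟨a, ha⟩ := exists_iterate_factorial_eq h
  refine hasCopy_zycle_of_box hne ha hA fun x hx => ?_
  obtain ⟨hxg, rfl⟩ := mem_filter.mp (hAS x hx)
  exact ⟨(mem_filter.mp hxg).2.1, fun i => (hg x hxg i).2⟩

/-- The `k`-sets of `Fin n` whose elements sum to `1` modulo `m`. -/
noncomputable def sumOneHypergraph (k n m : ℕ) : Finset (Finset (Fin n)) :=
  univ.filter fun e => e.card = k ∧ ∑ v ∈ e, ((v : ℕ) : ZMod m) = 1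

lemma le_hdeg_sumOneHypergraph {k n m : ℕ} (hk : 0 < k) (hm : 0 < m) {s : Finset (Fin n)}
    (hs : s.card = k - 1) : n / m - (k - 1) ≤ hdeg (sumOneHypergraph k n m) s := by
  have : NeZero m := ⟨hm.ne'⟩
  rw [hdeg_eq_card_filter hk (fun e he => (mem_filter.mp he).2.1) hs]
  set c : ZMod m := 1 - ∑ v ∈ s, ((v : ℕ) : ZMod m) with hc
  have hclass : n / m ≤ (univ.filter fun v : Fin n => ((v : ℕ) : ZMod m) = c).card := by
    have hlt : ∀ t : Fin (n / m), c.val + m * t < n := fun t => by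
      have h1 := ZMod.val_lt c
      have h2 : m * (t + 1) ≤ m * (n / m) := Nat.mul_le_mul_left _ t.isLt
      have h3 := Nat.mul_div_le n m
      rw [mul_add, mul_one] at h2
      omega
    have := card_le_card_of_injOn (s := (univ : Finset (Fin (n / m))))
      (t := univ.filter fun v : Fin n => ((v : ℕ) : ZMod m) = c)
      (fun t => ⟨c.val + m * t, hlt t⟩) (fun t _ => by simp) (fun t _ t' _ h => by
        have h' : c.val + m * t = c.val + m * t' := congrArg Fin.val h
        exact Fin.ext (Nat.eq_of_mul_eq_mul_left hm (Nat.add_left_cancel h')))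
    simpa using this
  rw [← hs]
  refine (Nat.sub_le_sub_right hclass _).trans ((le_card_sdiff _ _).trans (card_le_card ?_))
  intro v hv
  simp only [mem_sdiff, mem_filter, mem_univ, true_and] at hv
  simp only [sumOneHypergraph, mem_filter, mem_univ, true_and]
  refine ⟨hv.2, ?_, ?_⟩
  · rw [card_insert_of_notMem hv.2, hs]
    omega
  · rw [sum_insert hv.2, hv.1, hc, sub_add_cancel]

/-- With `q = -(k-1)`, a zycle of length `ℓ` in `sumOneHypergraph` gives a closed orbit of length
`ℓ` of the affine map `c ↦ q c + 1` modulo `m`. -/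
lemma exists_affine_cycle_of_hasCopy {k n m ℓ : ℕ} (hk : 2 ≤ k) (hℓ : 0 < ℓ)
    (h : HasCopy (zycle k ℓ) (sumOneHypergraph k n m)) :
    ∃ c : ZMod m, (fun x : ZMod m => -((k - 1 : ℕ) : ZMod m) * x + 1)^[ℓ] c = c := by
  obtain ⟨f, hf, hE⟩ := h
  let a : Fin ℓ × Fin (k - 1) → ZMod m := fun p => ((f p : ℕ) : ZMod m)
  have hstep : ∀ (i : Fin ℓ) (j : Fin (k - 1)),
      a (⟨(i.val + 1) % ℓ, Nat.mod_lt _ i.pos⟩, j) + ∑ j', a (i, j') = 1 := by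
    intro i j
    have hmem := (mem_filter.mp (hE _ (mem_image_of_mem _ (mem_univ (i, j))))).2
    obtain ⟨hcard, hsum⟩ := hmem
    rw [card_image_of_injective _ hf] at hcard
    rw [sum_image hf.injOn] at hsum
    have hinj : Function.Injective fun j' : Fin (k - 1) => (i, j') :=
      fun _ _ h => congrArg Prod.snd h
    have hnotMem : ((⟨(i.val + 1) % ℓ, Nat.mod_lt _ i.pos⟩, j) : Fin ℓ × Fin (k - 1)) ∉
        univ.image fun j' : Fin (k - 1) => (i, j') := by
      intro hmem
      simp only [insert_eq_of_mem hmem, card_image_of_injective _ hinj, card_univ,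
        Fintype.card_fin] at hcard
      omega
    rw [sum_insert hnotMem, sum_image hinj.injOn] at hsum
    exact hsum
  have hpred : ∀ i : Fin ℓ, ∃ i' : Fin ℓ,
      (⟨(i'.val + 1) % ℓ, Nat.mod_lt _ i'.pos⟩ : Fin ℓ) = i := by
    rintro ⟨i, hi⟩
    rcases Nat.eq_zero_or_pos i with rfl | hpos
    · refine ⟨⟨ℓ - 1, by omega⟩, Fin.ext ?_⟩
      simp [Nat.sub_add_cancel hℓ]
    · refine ⟨⟨i - 1, by omega⟩, Fin.ext ?_⟩
      simp [Nat.sub_add_cancel hpos, Nat.mod_eq_of_lt hi]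
  let j₀ : Fin (k - 1) := ⟨0, by omega⟩
  have hconst : ∀ i j, a (i, j) = a (i, j₀) := by
    intro i j
    obtain ⟨i', rfl⟩ := hpred i
    exact add_right_cancel ((hstep i' j).trans (hstep i' j₀).symm)
  have hnext : ∀ i : Fin ℓ, a (⟨(i.val + 1) % ℓ, Nat.mod_lt _ i.pos⟩, j₀) =
      -((k - 1 : ℕ) : ZMod m) * a (i, j₀) + 1 := by
    intro i
    have := hstep i j₀
    simp only [hconst i, sum_const, card_univ, Fintype.card_fin, nsmul_eq_mul] at this
    linear_combination this
  refine ⟨a (⟨0, hℓ⟩, j₀), ?_⟩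
  have hiter : ∀ t : ℕ, (fun x : ZMod m => -((k - 1 : ℕ) : ZMod m) * x + 1)^[t]
      (a (⟨0, hℓ⟩, j₀)) = a (⟨t % ℓ, Nat.mod_lt _ hℓ⟩, j₀) := by
    intro t
    induction t with
    | zero => simp
    | succ t ih =>
      rw [Function.iterate_succ_apply', ih, ← hnext]
      simp
  simpa using hiter ℓ

lemma affine_iterate {R : Type*} [CommRing R] (q c : R) (t : ℕ) :
    (fun x : R => q * x + 1)^[t] c = q ^ t * c + ∑ s ∈ range t, q ^ s := by
  induction t with
  | zero => simp
  | succ t ih =>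
    rw [Function.iterate_succ_apply', ih, geom_sum_succ]
    ring

/-- The modulus `|(-(k-1))^ℓ - 1|`, for which `sumOneHypergraph` has no zycle of length `ℓ`. -/
def zycleModulus (k ℓ : ℕ) : ℕ := ((-((k - 1 : ℕ) : ℤ)) ^ ℓ - 1).natAbs

lemma geom_sum_mul_eq (k ℓ : ℕ) (hk : 1 ≤ k) :
    (∑ s ∈ range ℓ, (-((k - 1 : ℕ) : ℤ)) ^ s) * (-(k : ℤ)) =
      (-((k - 1 : ℕ) : ℤ)) ^ ℓ - 1 := by
  rw [← geom_sum_mul]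
  congr 1
  push_cast [hk]
  ring

lemma zycleModulus_pos {k ℓ : ℕ} (hk : 3 ≤ k) (hℓ : 0 < ℓ) : 0 < zycleModulus k ℓ := by
  rw [zycleModulus, Int.natAbs_pos, sub_ne_zero]
  intro h
  have h' := congrArg Int.natAbs h
  rw [Int.natAbs_pow, Int.natAbs_neg, Int.natAbs_natCast, Int.natAbs_one] at h'
  have := Nat.one_lt_pow hℓ.ne' (by omega : 1 < k - 1)
  omega

lemma zycleModulus_le {k : ℕ} (hk : 2 ≤ k) (ℓ : ℕ) : zycleModulus k ℓ ≤ 2 * (k - 1) ^ ℓ := by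
  have h := Int.natAbs_sub_le ((-((k - 1 : ℕ) : ℤ)) ^ ℓ) 1
  rw [Int.natAbs_pow, Int.natAbs_neg, Int.natAbs_natCast, Int.natAbs_one] at h
  have := Nat.one_le_pow ℓ (k - 1) (by omega)
  rw [zycleModulus]
  omega

lemma not_hasCopy_sumOneHypergraph {k ℓ : ℕ} (hk : 3 ≤ k) (hℓ : 0 < ℓ) (n : ℕ) :
    ¬ HasCopy (zycle k ℓ) (sumOneHypergraph k n (zycleModulus k ℓ)) := by
  intro h
  set m := zycleModulus k ℓ
  obtain ⟨c, hc⟩ := exists_affine_cycle_of_hasCopy (by omega) hℓ h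
  rw [affine_iterate] at hc
  set q : ℤ := -((k - 1 : ℕ) : ℤ) with hq
  set G : ℤ := ∑ s ∈ range ℓ, q ^ s with hG
  have hGk : G * (-(k : ℤ)) = q ^ ℓ - 1 := geom_sum_mul_eq k ℓ (by omega)
  have hmdvd : (m : ℤ) ∣ q ^ ℓ - 1 := Int.natAbs_dvd.mpr dvd_rfl
  have hqm : ((q ^ ℓ - 1 : ℤ) : ZMod m) = 0 := (ZMod.intCast_zmod_eq_zero_iff_dvd _ _).mpr hmdvd
  have hG0 : (G : ZMod m) = 0 := by
    push_cast [hG, hq] at hqm ⊢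
    linear_combination hc - c * hqm
  have hGdvd : q ^ ℓ - 1 ∣ G :=
    Int.natAbs_dvd.mp ((ZMod.intCast_zmod_eq_zero_iff_dvd _ _).mp hG0)
  have hne : q ^ ℓ - 1 ≠ 0 := Int.natAbs_pos.mp (zycleModulus_pos hk hℓ)
  have hGne : G ≠ 0 := by
    rintro h0
    rw [h0, zero_mul] at hGk
    exact hne hGk.symm
  rw [← hGk] at hGdvd
  have hunit : -(k : ℤ) ∣ 1 := (mul_dvd_mul_iff_left hGne).mp (by rwa [mul_one])
  have := Int.le_of_dvd one_pos (neg_dvd.mp hunit)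
  omega

lemma le_exco {α : Type*} {k n d : ℕ} {F : Finset (Finset α)} (hn : k ≤ n)
    {E : Finset (Finset (Fin n))} (hE : ∀ e ∈ E, e.card = k) (hF : ¬ HasCopy F E)
    (hd : ∀ s : Finset (Fin n), s.card = k - 1 → d ≤ hdeg E s) : d ≤ exco k n F := by
  refine le_csSup ⟨Fintype.card (Finset (Fin n)), ?_⟩ ⟨E, hE, hF, hd⟩
  rintro d' ⟨E', -, -, hd'⟩
  obtain ⟨s, -, hs⟩ := exists_subset_card_eq (s := (univ : Finset (Fin n))) (n := k - 1)
    (by rw [card_univ, Fintype.card_fin]; omega)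
  exact (hd' s hs).trans (card_le_univ _)

lemma exco_le {α : Type*} {k n : ℕ} {F : Finset (Finset α)} {d : ℝ} (hd : 0 ≤ d)
    (h : ∀ E : Finset (Finset (Fin n)), (∀ e ∈ E, e.card = k) →
      (∀ s : Finset (Fin n), s.card = k - 1 → d ≤ hdeg E s) → HasCopy F E) :
    (exco k n F : ℝ) ≤ d := by
  have hfloor : exco k n F ≤ ⌊d⌋₊ := by
    refine csSup_le' ?_
    rintro d' ⟨E, hE, hF, hd'⟩
    by_contra hlt
    refine hF (h E hE fun s hs => ?_)
    exact ((Nat.floor_lt hd).mp (not_le.mp hlt)).le.trans (by exact_mod_cast hd' s hs)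
  exact (Nat.le_floor_iff hd).mp hfloor

/-- Let `k ≥ 3` be an integer. For every real `d ∈ (0,1]` there exists `ℓ ∈ ℕ`
such that `1/(2(k−1)^ℓ) ≤ γ(Z_ℓ^{(k)}) ≤ d`. -/
theorem statement2 (k : ℕ) (hk : 3 ≤ k) (d : ℝ) (hd : d ∈ Set.Ioc (0 : ℝ) 1) :
    ∃ ℓ : ℕ, (1 : ℝ) / (2 * ((k : ℝ) - 1) ^ ℓ) ≤ codegTuranDensity k (zycle k ℓ) ∧
      codegTuranDensity k (zycle k ℓ) ≤ d := by
  obtain ⟨ℓ, hℓ, n₀, hcopy⟩ := exists_zycle_of_codegree (by omega : 2 ≤ k) hd.1 hd.2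
  have hupper : ∀ᶠ n : ℕ in Filter.atTop, (exco k n (zycle k ℓ) : ℝ) / n ≤ d := by
    filter_upwards [Filter.eventually_ge_atTop n₀] with n hn
    refine div_le_of_le_mul₀ (Nat.cast_nonneg n) hd.1.le ?_
    exact exco_le (mul_nonneg hd.1.le (Nat.cast_nonneg n)) (hcopy n hn)
  have hnonneg : ∀ n : ℕ, (0 : ℝ) ≤ (exco k n (zycle k ℓ) : ℝ) / n := fun n => by positivity
  refine ⟨ℓ, ?_, Filter.limsup_le_of_le (Filter.isCoboundedUnder_le_of_le _ hnonneg) hupper⟩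
  set m := zycleModulus k ℓ with hm
  have hm0 : (0 : ℝ) < m := by exact_mod_cast zycleModulus_pos hk hℓ
  have hlower : ∀ᶠ n : ℕ in Filter.atTop,
      1 / (m : ℝ) - k / n ≤ (exco k n (zycle k ℓ) : ℝ) / n := by
    filter_upwards [Filter.eventually_ge_atTop k] with n hn
    have hn0 : (0 : ℝ) < n := by exact_mod_cast (by omega : 0 < n)
    have hle : n / m - (k - 1) ≤ exco k n (zycle k ℓ) :=
      le_exco hn (fun e he => (mem_filter.mp he).2.1) (not_hasCopy_sumOneHypergraph hk hℓ n)
        fun s hs => le_hdeg_sumOneHypergraph (by omega) (zycleModulus_pos hk hℓ) hs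
    have hle' : n / m + 1 ≤ exco k n (zycle k ℓ) + k := by omega
    have hle'' : ((n / m : ℕ) : ℝ) + 1 ≤ exco k n (zycle k ℓ) + k := by exact_mod_cast hle'
    have hdiv : (n : ℝ) / m < ((n / m : ℕ) : ℝ) + 1 := by
      rw [← Nat.floor_div_eq_div (K := ℝ)]
      exact Nat.lt_floor_add_one _
    rw [le_div_iff₀ hn0, sub_mul, div_mul_cancel₀ _ hn0.ne', one_div_mul_eq_div]
    linarith
  have hlim : Filter.Tendsto (fun n : ℕ => 1 / (m : ℝ) - k / n) Filter.atTop
      (nhds (1 / (m : ℝ))) := by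
    simpa using tendsto_const_nhds.sub (tendsto_const_div_atTop_nhds_zero_nat (k : ℝ))
  calc (1 : ℝ) / (2 * ((k : ℝ) - 1) ^ ℓ) ≤ 1 / m := by
        refine one_div_le_one_div_of_le hm0 ?_
        have h : (m : ℝ) ≤ ((2 * (k - 1) ^ ℓ : ℕ) : ℝ) := by
          exact_mod_cast zycleModulus_le (by omega : 2 ≤ k) ℓ
        rwa [Nat.cast_mul, Nat.cast_pow, Nat.cast_sub (by omega), Nat.cast_one,
          Nat.cast_ofNat] at h
    _ = Filter.limsup (fun n : ℕ => 1 / (m : ℝ) - k / n) Filter.atTop := hlim.limsup_eq.symm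
    _ ≤ codegTuranDensity k (zycle k ℓ) :=
        Filter.limsup_le_limsup hlower hlim.isCoboundedUnder_le
          (Filter.isBoundedUnder_of_eventually_le hupper)
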